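/- arXiv:1607.00367 — 2 statements merged into one kernel-verified Lean document; each statement's English description precedes it below -/
import Mathlib

section
/- Let (𝔤,⟨·,·⟩) be a metric Lie algebra with an abelian ideal 𝔲 of codimension 1 and b ∈ 𝔤 orthogonal to 𝔲 with [b,x] = x for all x ∈ 𝔲, λ = ⟨b,b⟩. Then the Levi-Civita product ∇̃ of the tangent algebra T𝔤 satisfies, for all x, y ∈ 𝔲: ∇̃_{b^c} b^c = ∇̃_{b^c} b^v = ∇̃_{b^v} b^c = ∇̃_{b^v} b^v = ∇̃_{b^c} x^c = ∇̃_{b^c} x^v = 0; ∇̃_{x^c} b^c = −x^c; ∇̃_{b^v} x^c = ½ x^v; ∇̃_{x^v} b^c = −x^v; ∇̃_{x^v} b^v = ∇̃_{b^v} x^v = −½ x^c; ∇̃_{x^c} b^v = −½ x^v; ∇̃_{x^c} y^c = ∇̃_{x^v} y^v = (⟨x,y⟩/λ) b^c; and ∇̃_{x^c} y^v = ∇̃_{x^v} y^c = (⟨x,y⟩/(2λ)) b^v. -/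
/-- Bracket of the tangent Lie algebra `T𝔤 = 𝔤 × 𝔤`. -/
def tangentBracket {G : Type*} [LieRing G] (p q : G × G) : G × G :=
  (⁅p.1, q.1⁆, ⁅p.1, q.2⁆ + ⁅p.2, q.1⁆)

/-- The lifted inner product on `T𝔤 = 𝔤 × 𝔤`. -/
def tangentInner {G : Type*} [AddCommGroup G] [Module ℝ G]
    (inn : G →ₗ[ℝ] G →ₗ[ℝ] ℝ) (p q : G × G) : ℝ :=
  inn p.1 q.1 + inn p.2 q.2

/-- A line orthogonal to a subspace of codimension one, together with that subspace, spans. -/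
lemma exists_eq_smul_add_of_orthogonal {V : Type*} [AddCommGroup V] [Module ℝ V]
    [Module.Finite ℝ V] (inn : V →ₗ[ℝ] V →ₗ[ℝ] ℝ) (u : Submodule ℝ V)
    (hcodim : Module.finrank ℝ V = Module.finrank ℝ u + 1) (b : V) (hb : inn b b ≠ 0)
    (hborth : ∀ x ∈ u, inn b x = 0) (z : V) : ∃ β : ℝ, ∃ x ∈ u, z = β • b + x := by
  have hbu : b ∉ u := fun h => hb (hborth b h)
  have hlt : u < u ⊔ Submodule.span ℝ {b} :=
    lt_of_le_of_ne le_sup_left fun h =>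
      hbu (h ▸ Submodule.mem_sup_right (Submodule.mem_span_singleton_self b))
  have htop : u ⊔ Submodule.span ℝ {b} = ⊤ := by
    apply Submodule.eq_top_of_finrank_eq
    have h₁ := Submodule.finrank_lt_finrank_of_lt hlt
    have h₂ := Submodule.finrank_le (u ⊔ Submodule.span ℝ {b})
    omega
  obtain ⟨x, hx, y, hy, hxy⟩ := Submodule.mem_sup.1 (htop ▸ Submodule.mem_top : z ∈ _)
  obtain ⟨β, rfl⟩ := Submodule.mem_span_singleton.1 hy
  exact ⟨β, x, hx, by rw [← hxy, add_comm]⟩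

/-- The lifted inner product is nondegenerate. -/
lemma eq_of_forall_tangentInner_eq {G : Type*} [AddCommGroup G] [Module ℝ G]
    (inn : G →ₗ[ℝ] G →ₗ[ℝ] ℝ) (hpos : ∀ x : G, x ≠ 0 → 0 < inn x x) {p q : G × G}
    (h : ∀ r, tangentInner inn p r = tangentInner inn q r) : p = q := by
  have h₁ : inn (p.1 - q.1) (p.1 - q.1) = 0 := by
    have := h (p.1 - q.1, 0)
    simp only [tangentInner, map_zero, add_zero] at this
    rw [map_sub inn, LinearMap.sub_apply, this, sub_self]
  have h₂ : inn (p.2 - q.2) (p.2 - q.2) = 0 := by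
    have := h (0, p.2 - q.2)
    simp only [tangentInner, map_zero, zero_add] at this
    rw [map_sub inn, LinearMap.sub_apply, this, sub_self]
  ext
  · by_contra hne
    exact (hpos _ (sub_ne_zero.2 hne)).ne' h₁
  · by_contra hne
    exact (hpos _ (sub_ne_zero.2 hne)).ne' h₂

/-- Let `(𝔤,⟨·,·⟩)` be a metric Lie algebra with an abelian ideal `𝔲` of codimension `1`
and `b` orthogonal to `𝔲` with `[b,x] = x` for all `x ∈ 𝔲`, `λ = ⟨b,b⟩`.  Then the
Levi-Civita product `∇̃` of the tangent algebra `T𝔤` satisfies the formulas of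
Lemma 1 (with the corrected values as stated). -/
theorem special_tangent_leviCivita_formulas
    {G : Type*} [LieRing G] [LieAlgebra ℝ G] [Module.Finite ℝ G]
    (inn : G →ₗ[ℝ] G →ₗ[ℝ] ℝ)
    (hsymm : ∀ x y : G, inn x y = inn y x)
    (hpos : ∀ x : G, x ≠ 0 → 0 < inn x x)
    (u : LieIdeal ℝ G)
    (hab : ∀ x ∈ u, ∀ y ∈ u, ⁅x, y⁆ = (0 : G))
    (hcodim : Module.finrank ℝ G = Module.finrank ℝ u + 1)
    (b : G)
    (hborth : ∀ x ∈ u, inn b x = 0)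
    (hbx : ∀ x ∈ u, ⁅b, x⁆ = x)
    (tnabla : G × G → G × G → G × G)
    (htkoszul : ∀ p q r : G × G,
      2 * tangentInner inn (tnabla p q) r =
        tangentInner inn (tangentBracket p q) r
          - tangentInner inn (tangentBracket q r) p
          + tangentInner inn (tangentBracket r p) q) :
    tnabla (b, 0) (b, 0) = 0 ∧
    tnabla (b, 0) (0, b) = 0 ∧
    tnabla (0, b) (b, 0) = 0 ∧
    tnabla (0, b) (0, b) = 0 ∧
    (∀ x ∈ u, tnabla (b, 0) (x, 0) = 0) ∧
    (∀ x ∈ u, tnabla (b, 0) (0, x) = 0) ∧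
    (∀ x ∈ u, tnabla (x, 0) (b, 0) = ((-x, 0) : G × G)) ∧
    (∀ x ∈ u, tnabla (0, b) (x, 0) = ((0, (1/2 : ℝ) • x) : G × G)) ∧
    (∀ x ∈ u, tnabla (0, x) (b, 0) = ((0, -x) : G × G)) ∧
    (∀ x ∈ u, tnabla (0, x) (0, b) = ((-((1/2 : ℝ) • x), 0) : G × G)) ∧
    (∀ x ∈ u, tnabla (0, b) (0, x) = ((-((1/2 : ℝ) • x), 0) : G × G)) ∧
    (∀ x ∈ u, tnabla (x, 0) (0, b) = ((0, -((1/2 : ℝ) • x)) : G × G)) ∧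
    (∀ x ∈ u, ∀ y ∈ u,
      tnabla (x, 0) (y, 0) = (((inn x y / inn b b) • b, 0) : G × G)) ∧
    (∀ x ∈ u, ∀ y ∈ u,
      tnabla (0, x) (0, y) = (((inn x y / inn b b) • b, 0) : G × G)) ∧
    (∀ x ∈ u, ∀ y ∈ u,
      tnabla (x, 0) (0, y) = ((0, (inn x y / (2 * inn b b)) • b) : G × G)) ∧
    (∀ x ∈ u, ∀ y ∈ u,
      tnabla (0, x) (y, 0) = ((0, (inn x y / (2 * inn b b)) • b) : G × G)) := by
  by_cases hb0 : b = 0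
  · subst hb0
    have hu : ∀ x ∈ u, x = 0 := fun x hx => by rw [← hbx x hx, zero_lie]
    have hzero : tnabla (0, 0) (0, 0) = (0, 0) := by
      apply eq_of_forall_tangentInner_eq inn hpos
      intro r
      have := htkoszul (0, 0) (0, 0) r
      simpa [tangentInner, tangentBracket] using this
    refine ⟨hzero, hzero, hzero, hzero, ?_, ?_, ?_, ?_, ?_, ?_, ?_, ?_, ?_, ?_, ?_, ?_⟩ <;>
      intro x hx <;> obtain rfl := hu x hx <;> try (intro y hy; obtain rfl := hu y hy)
    all_goals simp [hzero]
  have hlam : inn b b ≠ 0 := (hpos b hb0).ne'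
  have key : ∀ p q v : G × G,
      (∀ β ω : ℝ, ∀ z ∈ u, ∀ w ∈ u,
        2 * tangentInner inn v (β • b + z, ω • b + w) =
          tangentInner inn (tangentBracket p q) (β • b + z, ω • b + w)
            - tangentInner inn (tangentBracket q (β • b + z, ω • b + w)) p
            + tangentInner inn (tangentBracket (β • b + z, ω • b + w) p) q) →
      tnabla p q = v := by
    intro p q v h
    apply eq_of_forall_tangentInner_eq inn hpos
    rintro ⟨r, s⟩
    obtain ⟨β, z, hz, rfl⟩ :=
      exists_eq_smul_add_of_orthogonal inn u.toSubmodule hcodim b hlam hborth r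
    obtain ⟨ω, w, hw, rfl⟩ :=
      exists_eq_smul_add_of_orthogonal inn u.toSubmodule hcodim b hlam hborth s
    linarith [htkoszul p q (β • b + z, ω • b + w), h β ω z hz w hw]
  have hborth' : ∀ x ∈ u, inn x b = 0 := fun x hx => by rw [hsymm, hborth x hx]
  have hxb : ∀ x ∈ u, ⁅x, b⁆ = -x := fun x hx => by rw [← lie_skew, hbx x hx]
  refine ⟨?_, ?_, ?_, ?_, ?_, ?_, ?_, ?_, ?_, ?_, ?_, ?_, ?_, ?_, ?_, ?_⟩
  iterate 4
    apply key
    intro β ω z hz w hw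
    simp [tangentInner, tangentBracket, hbx, hxb, hborth', hz, hw]
  iterate 8
    intro x hx
    apply key
    intro β ω z hz w hw
    simp [tangentInner, tangentBracket, hbx, hxb, hborth', hab, hx, hz, hw,
      hsymm z x, hsymm w x] <;> ring
  all_goals
    intro x hx y hy
    apply key
    intro β ω z hz w hw
    simp [tangentInner, tangentBracket, hbx, hxb, hborth, hab, hx, hy, hz, hw,
      hsymm y x]
    field_simp <;> ring
end

section
/- Let (𝔤,⟨·,·⟩) be a metric Lie algebra whose derived algebra is one-dimensional and spanned by a unit vector e, with Γ = e^⊥, a ∈ Γ satisfying [x,e] = ⟨a,x⟩e for all x ∈ Γ, and skew-adjoint f : Γ → Γ satisfying [x,y] = ⟨f(x),y⟩e for all x,y ∈ Γ. Then the Levi-Civita product ∇̃ of the tangent algebra T𝔤 satisfies, for all x, y ∈ Γ: ∇̃_{e^c}e^c = ∇̃_{e^v}e^v = a^c; ∇̃_{e^c}e^v = ∇̃_{e^v}e^c = ½a^v; ∇̃_{e^c}x^c = (−½f(x) − ⟨x,a⟩e)^c; ∇̃_{x^c}e^c = −½f(x)^c; ∇̃_{x^v}e^v = ∇̃_{e^v}x^v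 = (−½f(x) − ½⟨a,x⟩e)^c; ∇̃_{e^v}x^c = (−½f(x) − ⟨x,a⟩e)^v; ∇̃_{x^c}e^v = −½f(x)^v; ∇̃_{e^c}x^v = −½⟨a,x⟩e^v; ∇̃_{x^v}e^c = ½⟨a,x⟩e^v; ∇̃_{x^c}y^c = ½⟨f(x),y⟩e^c; ∇̃_{x^c}y^v = ∇̃_{x^v}y^c = ½⟨f(x),y⟩e^v; and ∇̃_{x^v}y^v = 0. -/
/-- The lifted inner product of a definite form separates points. -/
theorem eq_of_tangentInner_eq {G : Type*} [AddCommGroup G] [Module ℝ G]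
    (inn : G →ₗ[ℝ] G →ₗ[ℝ] ℝ) (hpos : ∀ x : G, x ≠ 0 → 0 < inn x x) {p q : G × G}
    (h : ∀ r, 2 * tangentInner inn p r = 2 * tangentInner inn q r) : p = q := by
  have key : ∀ u v : G, (∀ z, inn u z = inn v z) → u = v := fun u v huv => by
    by_contra hne
    have hlt := hpos (u - v) (sub_ne_zero.mpr hne)
    simp [huv] at hlt
  refine Prod.ext (key _ _ fun z => ?_) (key _ _ fun z => ?_)
  · simpa [tangentInner] using h (z, 0)
  · simpa [tangentInner] using h (0, z)

/-- The bracket with `e`, extended from `e^⊥` to the whole algebra. -/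
theorem lie_unit_eq {G : Type*} [LieRing G] [LieAlgebra ℝ G] (inn : G →ₗ[ℝ] G →ₗ[ℝ] ℝ)
    {e a : G} (hunit : inn e e = 1) (hae : inn a e = 0)
    (haxe : ∀ x : G, inn e x = 0 → ⁅x, e⁆ = inn a x • e) (z : G) :
    ⁅z, e⁆ = inn a z • e := by
  simpa [hae] using haxe (z - inn e z • e) (by simp [hunit])

/-- The bracket with an element of `e^⊥`, extended from `e^⊥` to the whole algebra. -/
theorem lie_orthogonal_eq {G : Type*} [LieRing G] [LieAlgebra ℝ G]
    (inn : G →ₗ[ℝ] G →ₗ[ℝ] ℝ) {e a : G} (hunit : inn e e = 1)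
    (haxe : ∀ x : G, inn e x = 0 → ⁅x, e⁆ = inn a x • e) {f : G →ₗ[ℝ] G}
    (hfe : ∀ x : G, inn e x = 0 → inn (f x) e = 0)
    (hfbr : ∀ x y : G, inn e x = 0 → inn e y = 0 → ⁅x, y⁆ = inn (f x) y • e)
    {x : G} (hx : inn e x = 0) (z : G) :
    ⁅x, z⁆ = (inn (f x) z + inn e z * inn a x) • e := by
  have h := hfbr x (z - inn e z • e) hx (by simp [hunit])
  simp only [lie_sub, lie_smul, haxe x hx, map_sub, map_smul, hfe x hx, smul_zero,
    sub_zero] at h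
  rw [add_smul, mul_smul, ← h, sub_add_cancel]

/-- Let `(𝔤,⟨·,·⟩)` be a metric Lie algebra whose derived algebra is one-dimensional and
spanned by a unit vector `e`, with `Γ = e^⊥`, `a ∈ Γ` satisfying `[x,e] = ⟨a,x⟩e` for all
`x ∈ Γ`, and skew-adjoint `f : Γ → Γ` satisfying `[x,y] = ⟨f(x),y⟩e` for all `x,y ∈ Γ`.
Then the Levi-Civita product `∇̃` of the tangent algebra `T𝔤` satisfies the stated
formulas. -/
theorem oneDimCommutator_tangent_leviCivita_formulas
    {G : Type*} [LieRing G] [LieAlgebra ℝ G] [Module.Finite ℝ G]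
    (inn : G →ₗ[ℝ] G →ₗ[ℝ] ℝ)
    (hsymm : ∀ x y : G, inn x y = inn y x)
    (hpos : ∀ x : G, x ≠ 0 → 0 < inn x x)
    (e : G) (hunit : inn e e = 1)
    (hder : Submodule.span ℝ {z : G | ∃ x y : G, ⁅x, y⁆ = z} =
      Submodule.span ℝ ({e} : Set G))
    (a : G) (haG : inn e a = 0)
    (haxe : ∀ x : G, inn e x = 0 → ⁅x, e⁆ = inn a x • e)
    (f : G →ₗ[ℝ] G)
    (hfG : ∀ x : G, inn e x = 0 → inn e (f x) = 0)
    (hskew : ∀ x y : G, inn e x = 0 → inn e y = 0 → inn (f x) y = -inn x (f y))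
    (hfbr : ∀ x y : G, inn e x = 0 → inn e y = 0 → ⁅x, y⁆ = inn (f x) y • e)
    (tnabla : G × G → G × G → G × G)
    (htkoszul : ∀ p q r : G × G,
      2 * tangentInner inn (tnabla p q) r =
        tangentInner inn (tangentBracket p q) r
          - tangentInner inn (tangentBracket q r) p
          + tangentInner inn (tangentBracket r p) q) :
    tnabla (e, 0) (e, 0) = ((a, 0) : G × G) ∧
    tnabla (0, e) (0, e) = ((a, 0) : G × G) ∧
    tnabla (e, 0) (0, e) = ((0, (1/2 : ℝ) • a) : G × G) ∧
    tnabla (0, e) (e, 0) = ((0, (1/2 : ℝ) • a) : G × G) ∧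
    (∀ x : G, inn e x = 0 →
      tnabla (e, 0) (x, 0) = ((-((1/2 : ℝ) • f x) - inn x a • e, 0) : G × G) ∧
      tnabla (x, 0) (e, 0) = ((-((1/2 : ℝ) • f x), 0) : G × G) ∧
      tnabla (0, x) (0, e) =
        ((-((1/2 : ℝ) • f x) - ((1/2 : ℝ) * inn a x) • e, 0) : G × G) ∧
      tnabla (0, e) (0, x) =
        ((-((1/2 : ℝ) • f x) - ((1/2 : ℝ) * inn a x) • e, 0) : G × G) ∧
      tnabla (0, e) (x, 0) = ((0, -((1/2 : ℝ) • f x) - inn x a • e) : G × G) ∧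
      tnabla (x, 0) (0, e) = ((0, -((1/2 : ℝ) • f x)) : G × G) ∧
      tnabla (e, 0) (0, x) = ((0, -(((1/2 : ℝ) * inn a x) • e)) : G × G) ∧
      tnabla (0, x) (e, 0) = ((0, ((1/2 : ℝ) * inn a x) • e) : G × G)) ∧
    (∀ x y : G, inn e x = 0 → inn e y = 0 →
      tnabla (x, 0) (y, 0) = ((((1/2 : ℝ) * inn (f x) y) • e, 0) : G × G) ∧
      tnabla (x, 0) (0, y) = ((0, ((1/2 : ℝ) * inn (f x) y) • e) : G × G) ∧
      tnabla (0, x) (y, 0) = ((0, ((1/2 : ℝ) * inn (f x) y) • e) : G × G) ∧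
      tnabla (0, x) (0, y) = 0) := by
  have hae : inn a e = 0 := by rw [hsymm, haG]
  have hze := lie_unit_eq inn hunit hae haxe
  have hez (z : G) : ⁅e, z⁆ = -(inn a z • e) := by rw [← lie_skew, hze]
  have hfe (x : G) (hx : inn e x = 0) : inn (f x) e = 0 := by rw [hsymm, hfG x hx]
  have hxz {x : G} (hx : inn e x = 0) := lie_orthogonal_eq inn hunit haxe hfe hfbr hx
  have hzx {x : G} (hx : inn e x = 0) (z : G) :
      ⁅z, x⁆ = -((inn (f x) z + inn e z * inn a x) • e) := by rw [← lie_skew, hxz hx]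
  refine ⟨?_, ?_, ?_, ?_, fun x hx => ?_, fun x y hx hy => ?_⟩
  iterate 4
    · refine eq_of_tangentInner_eq inn hpos fun r => ?_
      rw [htkoszul]
      simp [tangentInner, tangentBracket, hze, hez, hunit] <;> ring
  · have hxa := hsymm x a
    refine ⟨?_, ?_, ?_, ?_, ?_, ?_, ?_, ?_⟩ <;>
    · refine eq_of_tangentInner_eq inn hpos fun r => ?_
      rw [htkoszul]
      simp [tangentInner, tangentBracket, hze, hez, hxz hx, hzx hx, hunit, hx, hxa]
      ring
  · refine ⟨?_, ?_, ?_, ?_⟩ <;>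
    · refine eq_of_tangentInner_eq inn hpos fun r => ?_
      rw [htkoszul]
      simp [tangentInner, tangentBracket, hxz hx, hxz hy, hzx hx, hx, hy] <;> ring
end
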